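/- For every integer N ≥ 2, the infimum of the objective F over the feasible set of the forward-reformulated problem (constraints: l1 ≥ 1, l1 + l2 + α ≥ f1 + f2 + β + 1, and l1 + l2 + α ≥ f2 + β + 1) equals the infimum of the objective G over the feasible set of the forward lower-bound problem. -/

import Mathlib

/-- The objective `G` of the lower-bound problems:
`G = √((c_fl² + c_mg² + N·c_ba²)/2) + (N−1)·√((f1−m1)² + (g1−l1)² + 4t)`. -/
noncomputable def Gobj (N : ℕ) (f1 g1 l1 m1 cfl cmg cba t : ℝ) : ℝ :=
  Real.sqrt ((cfl ^ 2 + cmg ^ 2 + N * cba ^ 2) / 2) +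
    ((N : ℝ) - 1) * Real.sqrt ((f1 - m1) ^ 2 + (g1 - l1) ^ 2 + 4 * t)

/-- The objective `F` (the nuclear norm in closed form). -/
noncomputable def Fobj (N : ℕ) (f1 f2 g1 g2 l1 l2 m1 m2 β α : ℝ) : ℝ :=
  let CA1 : ℝ := f1 ^ 2 + g1 ^ 2
  let CA2 : ℝ := 2 * f1 * f2 + N * f2 ^ 2 + 2 * g1 * g2 + N * g2 ^ 2 + β ^ 2
  let CD1 : ℝ := l1 ^ 2 + m1 ^ 2
  let CD2 : ℝ := 2 * l1 * l2 + N * l2 ^ 2 + 2 * m1 * m2 + N * m2 ^ 2 + α ^ 2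
  let CB1 : ℝ := f1 * l1 + g1 * m1
  let CB2 : ℝ := f1 * l2 + f2 * l1 + N * f2 * l2 + g1 * m2 + g2 * m1 + N * g2 * m2 + β * α
  Real.sqrt (CA1 + N * CA2 + CD1 + N * CD2 +
      2 * Real.sqrt ((CA1 + N * CA2) * (CD1 + N * CD2) - (CB1 + N * CB2) ^ 2)) +
    ((N : ℝ) - 1) * Real.sqrt (CA1 + CD1 + 2 * |f1 * m1 - g1 * l1|)

/-- Feasible set of the forward lower-bound problem. -/
def FeasFwdLB (N : ℕ) (f1 g1 l1 m1 cfl cmg cba t : ℝ) : Prop :=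
  1 ≤ l1 ∧
  ((N : ℝ) - 1) * f1 + cfl + N * cba + N ≤ ((N : ℝ) - 1) * l1 ∧
  -f1 + cfl + N * cba + N ≤ ((N : ℝ) - 1) * l1 ∧
  f1 * m1 ≤ t ∧
  g1 * l1 ≤ t

/-- For fixed `f1, g1, l1, m1`, the second term of `F` bounds the second term of `G` from below
at every feasible `t`. -/
lemma add_two_mul_abs_sub_le {f1 g1 l1 m1 t : ℝ} (hfm : f1 * m1 ≤ t) (hgl : g1 * l1 ≤ t) :
    f1 ^ 2 + g1 ^ 2 + (l1 ^ 2 + m1 ^ 2) + 2 * |f1 * m1 - g1 * l1| ≤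
      (f1 - m1) ^ 2 + (g1 - l1) ^ 2 + 4 * t := by
  rcases abs_cases (f1 * m1 - g1 * l1) with ⟨h, _⟩ | ⟨h, _⟩ <;> rw [h] <;> nlinarith

/-- The smallest feasible `t` makes the second terms of `F` and `G` agree. -/
lemma sub_sq_add_sub_sq_add_four_mul_max (f1 g1 l1 m1 : ℝ) :
    (f1 - m1) ^ 2 + (g1 - l1) ^ 2 + 4 * max (f1 * m1) (g1 * l1) =
      f1 ^ 2 + g1 ^ 2 + (l1 ^ 2 + m1 ^ 2) + 2 * |f1 * m1 - g1 * l1| := by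
  rcases le_total (f1 * m1) (g1 * l1) with h | h
  · rw [max_eq_right h, abs_of_nonpos (sub_nonpos.2 h)]
    ring
  · rw [max_eq_left h, abs_of_nonneg (sub_nonneg.2 h)]
    ring

lemma Gobj_nonneg {N : ℕ} (hN : 1 ≤ N) (f1 g1 l1 m1 cfl cmg cba t : ℝ) :
    0 ≤ Gobj N f1 g1 l1 m1 cfl cmg cba t := by
  have hN' : (0 : ℝ) ≤ N - 1 := sub_nonneg.2 (by exact_mod_cast hN)
  unfold Gobj
  positivity

lemma Fobj_nonneg {N : ℕ} (hN : 1 ≤ N) (f1 f2 g1 g2 l1 l2 m1 m2 β α : ℝ) :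
    0 ≤ Fobj N f1 f2 g1 g2 l1 l2 m1 m2 β α := by
  have hN' : (0 : ℝ) ≤ N - 1 := sub_nonneg.2 (by exact_mod_cast hN)
  unfold Fobj
  positivity

/-- `G` is at most `F` along the reduction to differences of the variables. -/
lemma Gobj_le_Fobj (N : ℕ) (f1 f2 g1 g2 l1 l2 m1 m2 β α : ℝ) :
    Gobj N f1 g1 l1 m1 (f1 + N * f2 - (l1 + N * l2)) (g1 + N * g2 - (m1 + N * m2)) (β - α)
      (max (f1 * m1) (g1 * l1)) ≤ Fobj N f1 f2 g1 g2 l1 l2 m1 m2 β α := by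
  unfold Gobj Fobj
  rw [sub_sq_add_sub_sq_add_four_mul_max]
  dsimp only
  gcongr ?_ + _
  refine Real.sqrt_le_sqrt (le_add_of_le_of_nonneg ?_ (by positivity))
  have hβα : 0 ≤ (N : ℝ) * (β + α) ^ 2 := by positivity
  nlinarith [sq_nonneg (f1 + N * f2 + (l1 + N * l2)), sq_nonneg (g1 + N * g2 + (m1 + N * m2))]

/-- `F` is at most `G` when the differences are split into antipodal halves. -/
lemma Fobj_le_Gobj {N : ℕ} (hN : 1 ≤ N) {f1 g1 l1 m1 t : ℝ} (cfl cmg cba : ℝ)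
    (hfm : f1 * m1 ≤ t) (hgl : g1 * l1 ≤ t) :
    Fobj N f1 ((cfl / 2 - f1) / N) g1 ((cmg / 2 - g1) / N) l1 ((-cfl / 2 - l1) / N)
      m1 ((-cmg / 2 - m1) / N) (cba / 2) (-cba / 2) ≤ Gobj N f1 g1 l1 m1 cfl cmg cba t := by
  have hN0 : (N : ℝ) ≠ 0 := by exact_mod_cast (by omega : N ≠ 0)
  have hN' : (0 : ℝ) ≤ N - 1 := sub_nonneg.2 (by exact_mod_cast hN)
  unfold Gobj Fobj
  dsimp only
  refine add_le_add (Real.sqrt_le_sqrt (le_of_eq ?_)) (mul_le_mul_of_nonneg_left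
    (Real.sqrt_le_sqrt (add_two_mul_abs_sub_le hfm hgl)) hN')
  have hsplit (x₁ y₁ x y b : ℝ) :
      x₁ ^ 2 + y₁ ^ 2 + N * (2 * x₁ * ((x - x₁) / N) + N * ((x - x₁) / N) ^ 2 +
        2 * y₁ * ((y - y₁) / N) + N * ((y - y₁) / N) ^ 2 + b ^ 2) = x ^ 2 + y ^ 2 + N * b ^ 2 := by
    field_simp
    ring
  have hcross :
      f1 * l1 + g1 * m1 + N * (f1 * ((-cfl / 2 - l1) / N) + (cfl / 2 - f1) / N * l1 +
        N * ((cfl / 2 - f1) / N) * ((-cfl / 2 - l1) / N) + g1 * ((-cmg / 2 - m1) / N) +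
        (cmg / 2 - g1) / N * m1 + N * ((cmg / 2 - g1) / N) * ((-cmg / 2 - m1) / N) +
        cba / 2 * (-cba / 2)) = -((cfl / 2) ^ 2 + (cmg / 2) ^ 2 + N * (cba / 2) ^ 2) := by
    field_simp
    ring
  rw [add_assoc _ (l1 ^ 2 + m1 ^ 2), hsplit, hsplit, hcross, Real.sqrt_eq_zero_of_nonpos]
  · ring
  · exact le_of_eq (by ring)

/-- The infimum of `F` over the feasible set of the
forward-reformulated problem (constraints `l1 ≥ 1`,
`l1 + l2 + α ≥ f1 + f2 + β + 1`, `l1 + l2 + α ≥ f2 + β + 1`) equals the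
infimum of `G` over the feasible set of the forward lower-bound problem. -/
theorem forward_lower_bound_same_value (N : ℕ) (hN : 2 ≤ N) :
    sInf {y : ℝ | ∃ f1 f2 g1 g2 l1 l2 m1 m2 β α : ℝ,
        (1 ≤ l1 ∧ f1 + f2 + β + 1 ≤ l1 + l2 + α ∧ f2 + β + 1 ≤ l1 + l2 + α) ∧
        y = Fobj N f1 f2 g1 g2 l1 l2 m1 m2 β α} =
    sInf {y : ℝ | ∃ f1 g1 l1 m1 cfl cmg cba t : ℝ,
        FeasFwdLB N f1 g1 l1 m1 cfl cmg cba t ∧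
        y = Gobj N f1 g1 l1 m1 cfl cmg cba t} := by
  have hN1 : 1 ≤ N := by omega
  have hN0 : (0 : ℝ) < N := by exact_mod_cast hN1
  have hN2 : (2 : ℝ) ≤ N := by exact_mod_cast hN
  apply le_antisymm
  · refine le_csInf ⟨_, 0, 0, 1, 0, -N, 0, 0, 0, ⟨?_, ?_, ?_, ?_, ?_⟩, rfl⟩ ?_
    · norm_num
    · linarith
    · linarith
    · norm_num
    · norm_num
    · rintro _ ⟨f1, g1, l1, m1, cfl, cmg, cba, t, ⟨hl, h₁, h₂, hfm, hgl⟩, rfl⟩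
      refine (csInf_le ⟨0, ?_⟩ ?_).trans (Fobj_le_Gobj hN1 cfl cmg cba hfm hgl)
      · rintro _ ⟨_, _, _, _, _, _, _, _, _, _, -, rfl⟩
        exact Fobj_nonneg hN1 _ _ _ _ _ _ _ _ _ _
      · refine ⟨_, _, _, _, _, _, _, _, _, _, ⟨hl, ?_, ?_⟩, rfl⟩
        · rw [← mul_le_mul_iff_right₀ hN0]
          field_simp
          linarith
        · rw [← mul_le_mul_iff_right₀ hN0]
          field_simp
          linarith
  · refine le_csInf ⟨_, 0, 0, 0, 0, 1, 0, 0, 0, 0, 0, by norm_num, rfl⟩ ?_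
    rintro _ ⟨f1, f2, g1, g2, l1, l2, m1, m2, β, α, ⟨hl, h₁, h₂⟩, rfl⟩
    refine (csInf_le ⟨0, ?_⟩ ?_).trans (Gobj_le_Fobj N f1 f2 g1 g2 l1 l2 m1 m2 β α)
    · rintro _ ⟨_, _, _, _, _, _, _, _, -, rfl⟩
      exact Gobj_nonneg hN1 _ _ _ _ _ _ _ _
    · refine ⟨_, _, _, _, _, _, _, _, ⟨hl, ?_, ?_, le_max_left _ _, le_max_right _ _⟩, rfl⟩
      · linarith [mul_le_mul_of_nonneg_left h₁ hN0.le]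
      · linarith [mul_le_mul_of_nonneg_left h₂ hN0.le]
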